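/- arXiv:1605.04989 — 14 statements merged into one kernel-verified Lean document; each statement's English description precedes it below -/
import Mathlib

section
/- Let m, t be positive integers, K = m·t, let d be a real number and α, β ≥ 0 reals. For a balanced order s : {0,…,K−1} → {1,…,m} (each label occurring exactly t times), define c_j(s) = #{ j' < j : s(j') ≠ s(j) } and the cut value cut(s) = Σ_{j=0}^{K−1} min(α, (d − c_j(s))·β). If α = d·β, or if α ≤ (d − (m−1)t)·β, then for EVERY balanced order s one has cut(s) = Σ_{i=1}^{m} t · min(α, (d − (i−1)t)·β); in particular the cut value is independent of the order of failures. -/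
/-- The number of failures outside the block of `j` is `K - t`. -/
lemma bfr_card_ne {m t K : ℕ} (s : Fin K → Fin m)
    (hbal : ∀ u : Fin m, (Finset.univ.filter (fun j => s j = u)).card = t) (j : Fin K) :
    (Finset.univ.filter (fun j' : Fin K => s j' ≠ s j)).card + t = K := by
  have h := Finset.card_filter_add_card_filter_not (s := (Finset.univ : Finset (Fin K)))
    (fun j' => s j' = s j)
  rw [hbal, Finset.card_univ, Fintype.card_fin] at h
  simp only [ne_eq]
  omega

/-- Double counting of the ordered pairs in different blocks. -/
lemma bfr_double {m t K : ℕ} (s : Fin K → Fin m)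
    (hbal : ∀ u : Fin m, (Finset.univ.filter (fun j => s j = u)).card = t) :
    2 * (∑ j : Fin K, (Finset.univ.filter
      (fun j' : Fin K => j' < j ∧ s j' ≠ s j)).card) + K * t = K * K := by
  have h1 : ∑ j : Fin K, ((Finset.univ.filter (fun j' : Fin K => s j' ≠ s j)).card + t)
      = K * K := by
    rw [Finset.sum_congr rfl (fun j _ => bfr_card_ne s hbal j)]
    simp
  have h2 : ∑ j : Fin K, (Finset.univ.filter (fun j' : Fin K => j' < j ∧ s j' ≠ s j)).card
      = ∑ j : Fin K, (Finset.univ.filter (fun j' : Fin K => j < j' ∧ s j' ≠ s j)).card := by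
    simp only [Finset.card_filter]
    rw [Finset.sum_comm]
    simp only [ne_comm]
  have h3 : ∀ j : Fin K, (Finset.univ.filter (fun j' : Fin K => s j' ≠ s j)).card
      = (Finset.univ.filter (fun j' : Fin K => j' < j ∧ s j' ≠ s j)).card
        + (Finset.univ.filter (fun j' : Fin K => j < j' ∧ s j' ≠ s j)).card := by
    intro j
    simp only [Finset.card_filter]
    rw [← Finset.sum_add_distrib]
    refine Finset.sum_congr rfl (fun j' _ => ?_)
    rcases lt_trichotomy j' j with h | h | h
    · simp [h, h.le, not_lt.mpr h.le]
    · simp [h]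
    · simp [h, not_lt.mpr h.le]
  rw [Finset.sum_add_distrib, Finset.sum_congr rfl (fun j _ => h3 j),
    Finset.sum_add_distrib, ← h2] at h1
  simp only [Finset.sum_const, Finset.card_univ, Fintype.card_fin, smul_eq_mul] at h1
  omega

/-- Theorem 1 (Case I.A) of the BFR paper, stated combinatorially: if
`α = d·β` or `α ≤ (d − (m−1)t)·β`, then for every balanced order `s` on
`K = m·t` failures over `m` blocks, the cut value
`Σ_j min(α, (d − c_j(s))·β)` equals `Σ_{i=1}^m t·min(α, (d − (i−1)t)·β)`. -/
theorem bfr_cut_order_independent (m t : ℕ) (hm : 0 < m) (ht : 0 < t)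
    (K : ℕ) (hK : K = m * t) (d α β : ℝ) (hα : 0 ≤ α) (hβ : 0 ≤ β)
    (hreg : α = d * β ∨ α ≤ (d - ((m : ℝ) - 1) * t) * β)
    (s : Fin K → Fin m)
    (hbal : ∀ u : Fin m, (Finset.univ.filter (fun j => s j = u)).card = t) :
    (∑ j : Fin K,
        min α ((d - ((Finset.univ.filter
          (fun j' : Fin K => j' < j ∧ s j' ≠ s j)).card : ℝ)) * β))
      = ∑ i ∈ Finset.range m, (t : ℝ) * min α ((d - (i : ℝ) * t) * β) := by
  rcases hreg with h | h
  · have hmin : ∀ c : ℝ, 0 ≤ c → min α ((d - c) * β) = (d - c) * β := by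
      intro c hc
      apply min_eq_right
      rw [h]
      nlinarith [mul_nonneg hc hβ]
    rw [Finset.sum_congr rfl (fun j _ => hmin _ (Nat.cast_nonneg _)),
      Finset.sum_congr rfl (fun (i : ℕ) _ => by rw [hmin ((i : ℝ) * t) (by positivity)]),
      ← Finset.sum_mul, Finset.sum_sub_distrib, ← Nat.cast_sum]
    have hd := bfr_double s hbal
    set S := ∑ j : Fin K, (Finset.univ.filter
      (fun j' : Fin K => j' < j ∧ s j' ≠ s j)).card
    have hd' : 2 * (S : ℝ) + K * t = K * K := by exact_mod_cast hd
    have hKr : (K : ℝ) = m * t := by exact_mod_cast hK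
    have hsum : ∀ n : ℕ, ∑ i ∈ Finset.range n, (t : ℝ) * ((d - (i : ℝ) * t) * β)
        = (n * t * d - t * t * (n * (n - 1) / 2)) * β := by
      intro n
      induction n with
      | zero => simp
      | succ n ih =>
        rw [Finset.sum_range_succ, ih]
        push_cast
        ring
    have hS : (S : ℝ) = t * t * (m * (m - 1) / 2) := by
      rw [hKr] at hd'
      linarith
    rw [hsum, hS]
    simp [hKr]
  · have hmin : ∀ c : ℝ, c ≤ ((m : ℝ) - 1) * t → min α ((d - c) * β) = α := by
      intro c hc
      apply min_eq_left
      nlinarith [mul_le_mul_of_nonneg_right hc hβ]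
    have hc : ∀ j : Fin K, ((Finset.univ.filter
        (fun j' : Fin K => j' < j ∧ s j' ≠ s j)).card : ℝ) ≤ ((m : ℝ) - 1) * t := by
      intro j
      have h1 := bfr_card_ne s hbal j
      have h2 : (Finset.univ.filter (fun j' : Fin K => j' < j ∧ s j' ≠ s j)).card
          ≤ (Finset.univ.filter (fun j' : Fin K => s j' ≠ s j)).card := by
        apply Finset.card_le_card
        intro x hx
        simp only [Finset.mem_filter, Finset.mem_univ, true_and] at hx ⊢
        exact hx.2
      have h3 : (Finset.univ.filter (fun j' : Fin K => j' < j ∧ s j' ≠ s j)).card + t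
          ≤ m * t := by omega
      have h4 : ((Finset.univ.filter (fun j' : Fin K => j' < j ∧ s j' ≠ s j)).card : ℝ) + t
          ≤ m * t := by exact_mod_cast h3
      linarith
    have hi : ∀ i ∈ Finset.range m, (t : ℝ) * min α ((d - (i : ℝ) * t) * β) = t * α := by
      intro i hi
      rw [hmin]
      have : (i : ℝ) + 1 ≤ m := by exact_mod_cast Finset.mem_range.mp hi
      exact mul_le_mul_of_nonneg_right (by linarith) (Nat.cast_nonneg _)
    rw [Finset.sum_congr rfl (fun j _ => hmin _ (hc j)), Finset.sum_congr rfl hi]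
    simp [hK]
    ring
end

section
/- Let b > ρ ≥ 0 be integers, t ≥ 1 an integer, k = (b−ρ)·t, d an integer with d > (b−ρ−1)·t, and M > 0 a real. Set α = M/k. Then β₀ = α/(d − (b−ρ−1)t) is the minimum of the set { β > 0 : M ≤ Σ_{i=1}^{b−ρ} t · min(α, (d − (i−1)t)·β) }, and the corresponding repair bandwidth satisfies d·β₀ = M·d / ( k·d − k²(b−ρ−1)/(b−ρ) ). -/
/-- BFR-MSR point of Corollary 1 (Case I.A): with `α = M/k`,
`β₀ = α/(d − (b−ρ−1)t)` is the minimum `β > 0` satisfying the file size bound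
`M ≤ Σ_{i=1}^{b−ρ} t·min(α, (d−(i−1)t)β)`, and the repair bandwidth satisfies
`d·β₀ = M·d/(k·d − k²(b−ρ−1)/(b−ρ))`. -/
theorem bfr_msr_point_caseIA (b ρ t d : ℕ) (hρb : ρ < b) (ht : 1 ≤ t)
    (k : ℕ) (hk : k = (b - ρ) * t)
    (hd : ((b : ℝ) - ρ - 1) * t < d) (M : ℝ) (hM : 0 < M)
    (α β₀ : ℝ) (hα : α = M / k)
    (hβ₀ : β₀ = α / ((d : ℝ) - ((b : ℝ) - ρ - 1) * t)) :
    IsLeast {β : ℝ | 0 < β ∧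
        M ≤ ∑ i ∈ Finset.range (b - ρ),
          (t : ℝ) * min α (((d : ℝ) - (i : ℝ) * t) * β)} β₀
    ∧ (d : ℝ) * β₀
        = M * d / ((k : ℝ) * d - (k : ℝ) ^ 2 * ((b : ℝ) - ρ - 1) / ((b : ℝ) - ρ)) := by
  obtain ⟨m, rfl⟩ : ∃ m, b = ρ + (m + 1) := ⟨b - ρ - 1, by omega⟩
  have hn : ρ + (m + 1) - ρ = m + 1 := by omega
  have hbm : ((ρ + (m + 1) : ℕ) : ℝ) - ρ - 1 = m := by push_cast; ring
  have hbn : ((ρ + (m + 1) : ℕ) : ℝ) - ρ = m + 1 := by push_cast; ring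
  rw [hn] at hk ⊢
  rw [hbm] at hd hβ₀ ⊢
  rw [hbn]
  have htR : (0 : ℝ) < t := by exact_mod_cast ht
  have hmR : (0 : ℝ) < (m : ℝ) + 1 := by positivity
  have hkR : (k : ℝ) = (m + 1) * t := by rw [hk]; push_cast; ring
  have hk0 : (0 : ℝ) < k := by rw [hkR]; positivity
  have hα0 : 0 < α := by rw [hα]; positivity
  have hMα : M = (m + 1) * (t * α) := by
    rw [hα, hkR]; field_simp
  have hD : (0 : ℝ) < d - m * t := by linarith
  have hβ0 : 0 < β₀ := by rw [hβ₀]; positivity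
  have hDβ : ((d : ℝ) - m * t) * β₀ = α := by
    rw [hβ₀]; field_simp
  refine ⟨⟨⟨hβ0, ?_⟩, ?_⟩, ?_⟩
  · have h : ∑ i ∈ Finset.range (m + 1), (t : ℝ) * min α (((d : ℝ) - (i : ℝ) * t) * β₀)
        = ∑ i ∈ Finset.range (m + 1), (t : ℝ) * α := by
      apply Finset.sum_congr rfl
      intro i hi
      have him : (i : ℝ) ≤ m := by
        exact_mod_cast Nat.lt_succ_iff.mp (Finset.mem_range.mp hi)
      rw [min_eq_left]
      rw [← hDβ]
      gcongr
    rw [h, Finset.sum_const, Finset.card_range, nsmul_eq_mul, hMα]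
    push_cast
    exact le_rfl
  · rintro β ⟨hβ, hle⟩
    by_contra! hlt
    have h1 : ((d : ℝ) - m * t) * β < α := by
      rw [← hDβ]
      exact mul_lt_mul_of_pos_left hlt hD
    have h2 : ∑ i ∈ Finset.range (m + 1), (t : ℝ) * min α (((d : ℝ) - (i : ℝ) * t) * β)
        < ∑ i ∈ Finset.range (m + 1), (t : ℝ) * α := by
      apply Finset.sum_lt_sum
      · intro i _
        exact mul_le_mul_of_nonneg_left (min_le_left _ _) htR.le
      · exact ⟨m, by simp, mul_lt_mul_of_pos_left (lt_of_le_of_lt (min_le_right _ _) h1) htR⟩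
    rw [Finset.sum_const, Finset.card_range, nsmul_eq_mul] at h2
    push_cast at h2
    linarith
  · have hden : (k : ℝ) * d - (k : ℝ) ^ 2 * m / (m + 1) = k * (d - m * t) := by
      rw [hkR]; field_simp
    rw [hden, hβ₀, hα]
    field_simp
end

section
/- Let b > σ > ρ ≥ 0 be integers, t ≥ 1 an integer, m = b−ρ, K = m·t, α, β ≥ 0 reals and d a real. For a balanced order s : {0,…,K−1} → {1,…,m}, let n_u^{<j}(s) = #{ j' < j : s(j') = u } and let c_j(s) = max over (b−σ)-element subsets S ⊆ {1,…,m}∖{s(j)} of Σ_{u∈S} n_u^{<j}(s), and set cut(s) = Σ_{j=0}^{K−1} min(α, (d − c_j(s))·β). Then for the sequential order s* given by s*(j) = ⌊j/t⌋ + 1 (all t failures of block 1, then all of block 2, etc.), one has cut(s*) = Σ_{i=1}^{b−σ} t · min(α, (d − (i−1)t)·β) + (σ−ρ) · t · min(α, (d − (b−σ)t)·β). -/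
theorem bfr_count (t m K : ℕ) (ht : 1 ≤ t) (hK : K = m * t)
    (s : Fin K → Fin m) (hs : ∀ j : Fin K, (s j : ℕ) = (j : ℕ) / t) (j : Fin K) (u : Fin m)
    (hu : u ≠ s j) :
    (Finset.univ.filter (fun j' : Fin K => j' < j ∧ s j' = u)).card
      = if u < s j then t else 0 := by
  split_ifs with h
  · have h1 : (u : ℕ) < (j : ℕ) / t := by rw [← hs]; exact h
    have h2 : ((u : ℕ) + 1) * t ≤ j := (Nat.le_div_iff_mul_le ht).1 h1
    have : (Finset.univ.filter (fun j' : Fin K => j' < j ∧ s j' = u)).map Fin.valEmbedding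
        = Finset.Ico ((u : ℕ) * t) (((u : ℕ) + 1) * t) := by
      ext x
      simp only [Finset.mem_map, Finset.mem_filter, Finset.mem_univ, true_and, Finset.mem_Ico,
        Fin.valEmbedding_apply]
      constructor
      · rintro ⟨y, ⟨_, hy⟩, rfl⟩
        have h3 : (y : ℕ) / t = u := by rw [← hs, hy]
        exact ⟨(Nat.le_div_iff_mul_le ht).1 h3.ge, (Nat.div_lt_iff_lt_mul ht).1 (by omega)⟩
      · rintro ⟨ha, hb⟩
        refine ⟨⟨x, by have := j.2; omega⟩, ⟨?_, ?_⟩, rfl⟩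
        · rw [Fin.lt_def]; simp only; omega
        · apply Fin.ext
          rw [hs]
          exact Nat.div_eq_of_lt_le ha hb
    rw [← Finset.card_map Fin.valEmbedding, this, Nat.card_Ico, Nat.add_mul]
    omega
  · rw [Finset.card_eq_zero, Finset.filter_eq_empty_iff]
    rintro y - ⟨hy, rfl⟩
    have h3 : s y ≤ s j := by
      rw [Fin.le_def, hs, hs]
      exact Nat.div_le_div_right (le_of_lt hy)
    exact h (lt_of_le_of_ne h3 hu)

theorem bfr_sup (t m K n : ℕ) (hn : n < m) (ht : 1 ≤ t) (hK : K = m * t)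
    (s : Fin K → Fin m) (hs : ∀ j : Fin K, (s j : ℕ) = (j : ℕ) / t) (j : Fin K) :
    ((Finset.powersetCard n (Finset.univ.erase (s j))).sup
            (fun S => ∑ u ∈ S, (Finset.univ.filter
              (fun j' : Fin K => j' < j ∧ s j' = u)).card))
      = min ((j : ℕ) / t) n * t := by
  have key : ∀ S ∈ Finset.powersetCard n (Finset.univ.erase (s j)),
      ∑ u ∈ S, (Finset.univ.filter (fun j' : Fin K => j' < j ∧ s j' = u)).card
        = (S.filter (fun u => u < s j)).card * t := by
    intro S hS
    rw [Finset.mem_powersetCard] at hS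
    rw [Finset.sum_congr rfl (fun u hu => bfr_count t m K ht hK s hs j u
      (Finset.ne_of_mem_erase (hS.1 hu))), ← Finset.sum_filter, Finset.sum_const, smul_eq_mul]
  apply le_antisymm
  · apply Finset.sup_le
    intro S hS
    rw [key S hS]
    rw [Finset.mem_powersetCard] at hS
    apply Nat.mul_le_mul_right
    apply le_min
    · calc _ ≤ (Finset.Iio (s j)).card := Finset.card_le_card (by
            intro x hx; simpa using (Finset.mem_filter.1 hx).2)
        _ = _ := by rw [Fin.card_Iio, hs]
    · exact (Finset.card_filter_le _ _).trans hS.2.le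
  · obtain ⟨T, hT, hTc⟩ := Finset.exists_subset_card_eq
      (s := Finset.Iio (s j)) (n := min ((j : ℕ) / t) n) (by rw [Fin.card_Iio, hs]; omega)
    have hT2 : T ⊆ Finset.univ.erase (s j) := by
      intro x hx
      have := Finset.mem_Iio.1 (hT hx)
      simp [this.ne]
    obtain ⟨S, hTS, hS, hSc⟩ := Finset.exists_subsuperset_card_eq hT2
      (n := n) (by omega) (by
        rw [Finset.card_erase_of_mem (Finset.mem_univ _), Finset.card_univ, Fintype.card_fin]
        omega)
    have hSm : S ∈ Finset.powersetCard n (Finset.univ.erase (s j)) :=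
      Finset.mem_powersetCard.2 ⟨hS, hSc⟩
    refine le_trans ?_ (Finset.le_sup hSm)
    rw [key S hSm, ← hTc]
    apply Nat.mul_le_mul_right
    apply Finset.card_le_card
    intro x hx
    exact Finset.mem_filter.2 ⟨hTS hx, Finset.mem_Iio.1 (hT hx)⟩

theorem bfr_sum_div (t m : ℕ) (ht : 1 ≤ t) (f : ℕ → ℝ) :
    ∑ j ∈ Finset.range (m * t), f (j / t) = ∑ i ∈ Finset.range m, (t : ℝ) * f i := by
  induction m with
  | zero => simp
  | succ m ih =>
    rw [Nat.add_mul, one_mul, Finset.sum_range_add, ih, Finset.sum_range_succ]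
    congr 1
    rw [Finset.sum_congr rfl (g := fun _ => f m)]
    · simp
    · intro x hx
      congr 1
      rw [Finset.mem_range] at hx
      rw [mul_comm, Nat.mul_add_div ht, Nat.div_eq_of_lt hx, add_zero]

/-- Lemma 2 (Case I.B: σ > ρ) of the BFR paper, stated combinatorially: for the
sequential failure order `s*(j) = ⌊j/t⌋` (0-indexed blocks), where a failed node
can only use the `b−σ` blocks holding the most previously repaired nodes, the cut
value equals
`Σ_{i=1}^{b−σ} t·min(α,(d−(i−1)t)β) + (σ−ρ)·t·min(α,(d−(b−σ)t)β)`. -/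
theorem bfr_cut_sequential_caseIB (b σ ρ : ℕ) (hρσ : ρ < σ) (hσb : σ < b)
    (t : ℕ) (ht : 1 ≤ t) (m : ℕ) (hm : m = b - ρ) (K : ℕ) (hK : K = m * t)
    (α β d : ℝ) (hα : 0 ≤ α) (hβ : 0 ≤ β)
    (sStar : Fin K → Fin m) (hs : ∀ j : Fin K, (sStar j : ℕ) = (j : ℕ) / t) :
    (∑ j : Fin K,
        min α ((d - (((Finset.powersetCard (b - σ) (Finset.univ.erase (sStar j))).sup
            (fun S => ∑ u ∈ S, (Finset.univ.filter
              (fun j' : Fin K => j' < j ∧ sStar j' = u)).card) : ℕ) : ℝ)) * β))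
      = (∑ i ∈ Finset.range (b - σ), (t : ℝ) * min α ((d - (i : ℝ) * t) * β))
        + ((σ : ℝ) - ρ) * t * min α ((d - ((b : ℝ) - σ) * t) * β) := by
  have hn : b - σ < m := by omega
  simp_rw [bfr_sup t m K (b - σ) hn ht hK sStar hs]
  rw [Fin.sum_univ_eq_sum_range
    (fun j => min α ((d - ((min (j / t) (b - σ) * t : ℕ) : ℝ)) * β)) K, hK,
    bfr_sum_div t m ht (fun i => min α ((d - ((min i (b - σ) * t : ℕ) : ℝ)) * β))]
  have hm2 : m = (b - σ) + (σ - ρ) := by omega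
  rw [hm2, Finset.sum_range_add]
  congr 1
  · apply Finset.sum_congr rfl
    intro i hi
    rw [min_eq_left (Finset.mem_range.1 hi).le]
    push_cast
    rfl
  · rw [Finset.sum_congr rfl
      (g := fun _ => (t : ℝ) * min α ((d - ((b : ℝ) - σ) * t) * β))]
    · rw [Finset.sum_const, Finset.card_range, nsmul_eq_mul, Nat.cast_sub hρσ.le, mul_assoc]
    · intro i _
      rw [min_eq_right (Nat.le_add_right _ _), Nat.cast_mul, Nat.cast_sub hσb.le]
end

section
/- Let b > ρ > σ ≥ 0 be integers, m = b−ρ ≥ 1, and let d_r, k_c be integers with 1 ≤ d_r < k_c; set d = (b−σ)·d_r and K = m·k_c. Let α, β ≥ 0 be reals. For a balanced order s : {0,…,K−1} → {1,…,m} (each label occurring exactly k_c times), let n_u^{<j}(s) = #{ j' < j : s(j') = u }, c_j(s) = Σ_{u≠s(j)} min( n_u^{<j}(s), d_r ), and cut(s) = Σ_{j=0}^{K−1} min(α, (d − c_j(s))·β). Then the minimum of cut(s) over all balanced orders s equals Σ_{i=1}^{m} d_r · min(α, (d − (i−1)d_r)·β) + m·(k_c − d_r) · min(α, (d − (m−1)d_r)·β).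 -/
namespace BFRAux

open Finset

lemma bfr_rank {ι : Type*} [LinearOrder ι] (r : ℕ) (A : Finset ι) :
    (A.filter (fun x => (A.filter (fun y => y < x)).card < r)).card = min A.card r := by
  induction A using Finset.induction_on_max with
  | empty => simp
  | insert a A ha ih =>
    have hna : a ∉ A := fun h => lt_irrefl _ (ha a h)
    have h1 : (insert a A).filter (fun y => y < a) = A := by
      ext y
      simp only [mem_filter, mem_insert]
      constructor
      · rintro ⟨h | h, h'⟩
        · exact absurd (h ▸ h') (lt_irrefl _)
        · exact h
      · exact fun h => ⟨Or.inr h, ha y h⟩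
    have h2 : ∀ x ∈ A, (insert a A).filter (fun y => y < x) = A.filter (fun y => y < x) := by
      intro x hx
      rw [filter_insert, if_neg (not_lt.2 (ha x hx).le)]
    have h3 : A.filter (fun x => ((insert a A).filter (fun y => y < x)).card < r)
        = A.filter (fun x => (A.filter (fun y => y < x)).card < r) := by
      apply filter_congr
      intro x hx
      rw [h2 x hx]
    rw [filter_insert, h1, h3, card_insert_of_notMem hna]
    split_ifs with h
    · rw [card_insert_of_notMem (by simp [hna]), ih]
      omega
    · rw [ih]; omega

lemma bfr_H (dr p n : ℕ) (hdr : 1 ≤ dr) (hn : n ≤ dr) :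
    (p / dr) * dr ^ 2 + (p % dr) ^ 2 + n ^ 2
      ≤ ((p + n) / dr) * dr ^ 2 + ((p + n) % dr) ^ 2 := by
  have hr : p % dr < dr := Nat.mod_lt _ hdr
  have hp := Nat.div_add_mod p dr
  set q := p / dr
  set r := p % dr
  by_cases h : r + n < dr
  · have e : p + n = (r + n) + dr * q := by omega
    rw [e, Nat.add_mul_div_left _ _ hdr, Nat.add_mul_mod_self_left, Nat.div_eq_of_lt h,
      Nat.mod_eq_of_lt h]
    nlinarith [Nat.zero_le (r * n)]
  · obtain ⟨t, ht⟩ : ∃ t, r + n = dr + t := ⟨r + n - dr, by omega⟩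
    have htl : t < dr := by omega
    have e : p + n = t + dr * (q + 1) := by rw [mul_add]; omega
    rw [e, Nat.add_mul_div_left _ _ hdr, Nat.add_mul_mod_self_left, Nat.div_eq_of_lt htl,
      Nat.mod_eq_of_lt htl]
    obtain ⟨x, hx⟩ : ∃ x, r = t + x := ⟨r - t, by omega⟩
    clear_value q r
    obtain ⟨y, hy⟩ : ∃ y, n = t + y := ⟨n - t, by omega⟩
    have h6 : dr = t + x + y := by omega
    subst hx hy h6
    nlinarith [Nat.zero_le (x * y)]

lemma bfr_sq {κ : Type*} [DecidableEq κ] (U : Finset κ) (n : κ → ℕ) (dr : ℕ) (hdr : 1 ≤ dr)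
    (hn : ∀ u, n u ≤ dr) :
    ∑ u ∈ U, (n u) ^ 2 ≤ ((∑ u ∈ U, n u) / dr) * dr ^ 2 + ((∑ u ∈ U, n u) % dr) ^ 2 := by
  induction U using Finset.induction_on with
  | empty => simp
  | insert a U ha ih =>
    rw [sum_insert ha, sum_insert ha, add_comm (n a), add_comm (n a ^ 2)]
    have := bfr_H dr (∑ u ∈ U, n u) (n a) hdr (hn a)
    omega

lemma bfr_x (dr p : ℕ) (hdr : 1 ≤ dr) :
    2 * ∑ t ∈ range p, dr * (t / dr) + ((p / dr) * dr ^ 2 + (p % dr) ^ 2) = p ^ 2 := by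
  induction p with
  | zero => simp
  | succ p ih =>
    rw [sum_range_succ]
    have hr : p % dr < dr := Nat.mod_lt _ hdr
    have hp := Nat.div_add_mod p dr
    set q := p / dr
    set r := p % dr
    by_cases h : r + 1 < dr
    · have e : p + 1 = (r + 1) + dr * q := by omega
      have e1 : (p + 1) / dr = q := by
        rw [e, Nat.add_mul_div_left _ _ hdr, Nat.div_eq_of_lt h]; simp
      have e2 : (p + 1) % dr = r + 1 := by
        rw [e, Nat.add_mul_mod_self_left, Nat.mod_eq_of_lt h]
      rw [e1, e2]
      nlinarith
    · have hh : dr = r + 1 := by omega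
      have e : p + 1 = 0 + dr * (q + 1) := by rw [mul_add]; omega
      have e1 : (p + 1) / dr = q + 1 := by
        rw [e, Nat.add_mul_div_left _ _ hdr]; simp
      have e2 : (p + 1) % dr = 0 := by
        rw [e, Nat.add_mul_mod_self_left]; simp
      rw [e1, e2]
      have hz : ((dr:ℕ):ℤ) = r + 1 := by exact_mod_cast hh
      zify at *
      have hr' : (r:ℤ) = dr - 1 := by linarith
      rw [hr'] at ih hp
      rw [← hp] at ih ⊢
      linarith

lemma bfr_D {ι : Type*} [LinearOrder ι] {m : ℕ} (s : ι → Fin m) (A : Finset ι) :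
    2 * ∑ j ∈ A, (A.filter (fun i => i < j ∧ s i ≠ s j)).card
      + ∑ u : Fin m, (A.filter (fun i => s i = u)).card ^ 2 = A.card ^ 2 := by
  have h1 : A.card ^ 2 = ∑ j ∈ A, ∑ i ∈ A, 1 := by simp [sq]
  have h2 : ∀ j i : ι, 1 = (if i < j ∧ s i ≠ s j then 1 else 0)
      + (if j < i ∧ s j ≠ s i then 1 else 0) + (if s i = s j then 1 else 0) := by
    intro j i
    rcases lt_trichotomy i j with h | h | h
    · by_cases e : s i = s j <;> simp [h, e, h.le, not_lt.2 h.le]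
    · subst h; simp
    · by_cases e : s i = s j
      · simp [e]
      · have e' : s j ≠ s i := fun h => e h.symm
        simp [h, e, e', not_lt.2 h.le]
  have h3 : ∑ u : Fin m, (A.filter (fun i => s i = u)).card ^ 2
      = ∑ j ∈ A, ∑ i ∈ A, if s i = s j then 1 else 0 := by
    rw [← sum_fiberwise A s]
    apply sum_congr rfl
    intro u _
    rw [sq, ← smul_eq_mul, ← sum_const]
    apply sum_congr rfl
    intro j hj
    rw [card_filter, (mem_filter.1 hj).2]
  rw [h1, h3]
  conv_rhs => enter [2, j, 2, i]; rw [h2 j i]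
  simp only [sum_add_distrib]
  rw [sum_comm (f := fun j i => if j < i ∧ s j ≠ s i then 1 else 0)]
  simp only [card_filter]
  ring

lemma bfr_xsum (dr m : ℕ) (hdr : 1 ≤ dr) (F : ℝ → ℝ) :
    ∑ t ∈ range (m * dr), F ((dr * (t / dr) : ℕ) : ℝ)
      = ∑ i ∈ range m, (dr : ℝ) * F ((i : ℝ) * dr) := by
  induction m with
  | zero => simp
  | succ m ih =>
    rw [add_mul, one_mul, sum_range_add, ih, sum_range_succ]
    congr 1
    rw [← nsmul_eq_mul]
    conv_rhs => rw [← card_range dr, ← sum_const]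
    apply sum_congr rfl
    intro t ht
    have : (m * dr + t) / dr = m := by
      rw [mul_comm, Nat.mul_add_div hdr, Nat.div_eq_of_lt (mem_range.1 ht)]; simp
    rw [this]; simp [mul_comm]

/-- the early part of the lower bound -/
lemma bfr_early {ι : Type*} [LinearOrder ι] {m : ℕ} (s : ι → Fin m) (E : Finset ι) (dr : ℕ)
    (hdr : 1 ≤ dr) (hE : ∀ u, (E.filter (fun i => s i = u)).card = dr)
    (c : ι → ℕ) (hc : ∀ j ∈ E, c j ≤ (E.filter (fun i => i < j ∧ s i ≠ s j)).card)
    (d α β : ℝ) (hβ : 0 ≤ β) :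
    ∑ t ∈ range (m * dr), min α ((d - ((dr * (t / dr) : ℕ) : ℝ)) * β)
      ≤ ∑ j ∈ E, min α ((d - c j) * β) := by
  classical
  have hcE : E.card = m * dr := by
    rw [card_eq_sum_card_fiberwise (f := s) (t := univ) (by intro x _; simp)]
    simp [hE]
  set S := E.filter (fun j => α ≤ (d - c j) * β) with hS
  set S' := E.filter (fun j => ¬ α ≤ (d - c j) * β) with hS'
  have hSE : S ⊆ E := filter_subset _ _
  set e : ι → ℕ := fun j => (E.filter (fun i => i < j ∧ s i ≠ s j)).card with he
  have hcard : S.card + S'.card = m * dr := by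
    rw [← hcE]; exact card_filter_add_card_filter_not _
  have hple : S.card ≤ m * dr := by omega
  have hsplit : ∑ j ∈ S, e j + ∑ j ∈ S', e j = ∑ j ∈ E, e j :=
    sum_filter_add_sum_filter_not _ _ _
  have hDE := bfr_D s E
  have hDS := bfr_D s S
  have hSS : ∑ j ∈ S, (S.filter (fun i => i < j ∧ s i ≠ s j)).card ≤ ∑ j ∈ S, e j :=
    sum_le_sum fun j _ => card_le_card (filter_subset_filter _ hSE)
  have hsq := bfr_sq univ (fun u => (S.filter (fun i => s i = u)).card) dr hdr (by
    intro u
    rw [← hE u]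
    exact card_le_card (filter_subset_filter _ hSE))
  have hScard : ∑ u : Fin m, (S.filter (fun i => s i = u)).card = S.card :=
    (card_eq_sum_card_fiberwise (f := s) (t := univ) (by intro x _; simp)).symm
  simp only [hScard] at hsq
  have hx1 := bfr_x dr S.card hdr
  have hx2 := bfr_x dr (m * dr) hdr
  simp only [hE, sum_const, card_univ, Fintype.card_fin, smul_eq_mul] at hDE
  rw [hcE] at hDE
  rw [Nat.mul_div_cancel _ hdr, Nat.mul_mod_left] at hx2
  have hcS' : ∑ j ∈ S', c j ≤ ∑ j ∈ S', e j :=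
    sum_le_sum fun j hj => hc j (mem_filter.1 hj).1
  change 2 * ∑ j ∈ E, e j + _ = _ at hDE
  have hxs := sum_range_add_sum_Ico (fun t => dr * (t / dr)) hple
  have key : ∑ j ∈ S', c j ≤ ∑ t ∈ Ico S.card (m * dr), dr * (t / dr) := by omega
  have hR : ∑ j ∈ E, min α ((d - c j) * β) = S.card * α + ∑ j ∈ S', (d - c j) * β := by
    rw [← sum_filter_add_sum_filter_not E (fun j => α ≤ (d - c j) * β)]
    congr 1
    · rw [← nsmul_eq_mul, ← sum_const]
      exact sum_congr rfl fun j hj => min_eq_left (mem_filter.1 hj).2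
    · exact sum_congr rfl fun j hj => min_eq_right (not_le.1 (mem_filter.1 hj).2).le
  have hL : ∑ t ∈ range (m * dr), min α ((d - ((dr * (t / dr) : ℕ) : ℝ)) * β)
      ≤ S.card * α + ∑ t ∈ Ico S.card (m * dr), (d - ((dr * (t / dr) : ℕ) : ℝ)) * β := by
    rw [← sum_range_add_sum_Ico _ hple]
    apply add_le_add
    · calc _ ≤ ∑ t ∈ range S.card, α := sum_le_sum fun t _ => min_le_left _ _
        _ = _ := by simp
    · exact sum_le_sum fun t _ => min_le_right _ _
  refine hL.trans ?_
  rw [hR, ← sum_mul, ← sum_mul, sum_sub_distrib, sum_sub_distrib, sum_const, sum_const,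
    Nat.card_Ico, ← Nat.cast_sum, ← Nat.cast_sum]
  have : m * dr - S.card = S'.card := by omega
  rw [this]
  have key' : ((∑ j ∈ S', c j : ℕ) : ℝ) ≤ ((∑ t ∈ Ico S.card (m * dr), dr * (t / dr) : ℕ) : ℝ) := by
    exact_mod_cast key
  gcongr

/-- lower bound -/
lemma bfr_lower (m dr kc K : ℕ) (hdr : 1 ≤ dr) (hdk : dr < kc) (hK : K = m * kc)
    (d α β : ℝ) (hβ : 0 ≤ β) (s : Fin K → Fin m)
    (hs : ∀ u : Fin m, (Finset.univ.filter (fun j => s j = u)).card = kc) :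
    (∑ i ∈ Finset.range m, (dr : ℝ) * min α ((d - (i : ℝ) * dr) * β))
        + (m : ℝ) * ((kc : ℝ) - dr) * min α ((d - ((m : ℝ) - 1) * dr) * β)
      ≤ ∑ j : Fin K,
          min α ((d - ((∑ u ∈ Finset.univ.erase (s j),
            min ((Finset.univ.filter
              (fun j' : Fin K => j' < j ∧ s j' = u)).card) dr : ℕ) : ℝ)) * β) := by
  classical
  set c : Fin K → ℕ := fun j => ∑ u ∈ Finset.univ.erase (s j),
            min ((Finset.univ.filter
              (fun j' : Fin K => j' < j ∧ s j' = u)).card) dr with hc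
  set P : Fin K → Prop := fun j => (univ.filter (fun i => i < j ∧ s i = s j)).card < dr with hP
  set E := univ.filter P with hE
  have hEu : ∀ u, (E.filter (fun i => s i = u)).card = dr := by
    intro u
    have := bfr_rank dr (univ.filter (fun j => s j = u))
    rw [hs, min_eq_right hdk.le] at this
    rw [← this]
    congr 1
    ext i
    simp only [hE, hP, mem_filter, mem_univ, true_and, filter_filter]
    constructor
    · rintro ⟨h, rfl⟩
      refine ⟨rfl, ?_⟩
      simpa only [and_comm] using h
    · rintro ⟨rfl, h⟩
      refine ⟨?_, rfl⟩
      simpa only [and_comm] using h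
  have hcE : E.card = m * dr := by
    rw [card_eq_sum_card_fiberwise (f := s) (t := univ) (by intro x _; simp)]
    simp [hEu]
  have hcc : ∀ j, c j ≤ (E.filter (fun i => i < j ∧ s i ≠ s j)).card := by
    intro j
    rw [card_eq_sum_card_fiberwise (f := s) (t := univ.erase (s j)) (by
      intro x hx
      have := (mem_filter.1 hx).2.2
      simpa using this)]
    apply sum_le_sum
    intro u hu
    rw [← bfr_rank]
    apply card_le_card
    intro i hi
    simp only [mem_filter, mem_univ, true_and, filter_filter, hE, hP] at hi ⊢
    obtain ⟨⟨h1, h2⟩, h3⟩ := hi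
    refine ⟨⟨?_, h1, ?_⟩, h2⟩
    · refine lt_of_le_of_lt (card_le_card ?_) h3
      intro x hx
      simp only [mem_filter, mem_univ, true_and] at hx ⊢
      exact ⟨⟨hx.1.trans h1, hx.2.trans h2⟩, hx.1⟩
    · rw [h2]; exact (mem_erase.1 hu).1
  have hmain := bfr_early s E dr hdr hEu c (fun j _ => hcc j) d α β hβ
  rw [bfr_xsum dr m hdr (fun x => min α ((d - x) * β))] at hmain
  rw [← sum_filter_add_sum_filter_not univ P]
  refine add_le_add hmain ?_
  have hcl : (univ.filter (fun j => ¬ P j)).card = m * (kc - dr) := by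
    have h := card_filter_add_card_filter_not (s := (univ : Finset (Fin K))) P
    rw [card_univ, Fintype.card_fin] at h
    have hcE' : (univ.filter P).card = m * dr := hcE
    rw [Nat.mul_sub]
    omega
  have hcl' : (m : ℝ) * ((kc : ℝ) - dr) = ((univ.filter (fun j => ¬ P j)).card : ℝ) := by
    rw [hcl]; push_cast [Nat.cast_sub hdk.le]; ring
  rw [hcl', ← nsmul_eq_mul, ← sum_const]
  apply sum_le_sum
  intro j _
  have hm : 1 ≤ m := by have := (s j).pos; omega
  have hj : c j ≤ (m - 1) * dr := by
    calc c j ≤ ∑ u ∈ univ.erase (s j), dr := sum_le_sum fun u _ => min_le_right _ _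
      _ = _ := by simp [card_erase_of_mem]
  have hj' : (c j : ℝ) ≤ ((m : ℝ) - 1) * dr := by
    have : (c j : ℝ) ≤ (((m - 1) * dr : ℕ) : ℝ) := by exact_mod_cast hj
    rwa [Nat.cast_mul, Nat.cast_sub hm, Nat.cast_one] at this
  change _ ≤ min α ((d - (c j : ℝ)) * β)
  gcongr

/-- number of indices of `Fin K` in an interval -/
lemma bfr_Ico (K a n : ℕ) (h : a + n ≤ K) :
    (univ.filter (fun j : Fin K => a ≤ j.val ∧ j.val < a + n)).card = n := by
  rw [← card_map Fin.valEmbedding]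
  have : (univ.filter (fun j : Fin K => a ≤ j.val ∧ j.val < a + n)).map Fin.valEmbedding
      = Ico a (a + n) := by
    ext x
    simp only [mem_map, mem_filter, mem_univ, true_and, mem_Ico, Fin.valEmbedding_apply]
    constructor
    · rintro ⟨j, h, rfl⟩; exact h
    · intro hx; exact ⟨⟨x, by omega⟩, hx, rfl⟩
  rw [this]; simp

lemma bfr_upper (m dr kc K : ℕ) (hm1 : 1 ≤ m) (hdr : 1 ≤ dr) (hdk : dr < kc) (hK : K = m * kc)
    (d α β : ℝ) (hβ : 0 ≤ β) :
    ∃ s : Fin K → Fin m,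
    (∀ u : Fin m, (Finset.univ.filter (fun j => s j = u)).card = kc) ∧
    ∑ j : Fin K,
          min α ((d - ((∑ u ∈ Finset.univ.erase (s j),
            min ((Finset.univ.filter
              (fun j' : Fin K => j' < j ∧ s j' = u)).card) dr : ℕ) : ℝ)) * β) ≤
    (∑ i ∈ Finset.range m, (dr : ℝ) * min α ((d - (i : ℝ) * dr) * β))
        + (m : ℝ) * ((kc : ℝ) - dr) * min α ((d - ((m : ℝ) - 1) * dr) * β) := by
  classical
  obtain ⟨l, rfl⟩ : ∃ l, kc = dr + l := ⟨kc - dr, by omega⟩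
  have hl : 0 < l := by omega
  have hKe : K = m * dr + m * l := by rw [hK, mul_add]
  have hg : ∀ j : Fin K, (if j.val < m * dr then j.val / dr else (j.val - m * dr) / l) < m := by
    intro j
    have := j.isLt
    split_ifs with h
    · exact Nat.div_lt_of_lt_mul (by rwa [mul_comm])
    · exact Nat.div_lt_of_lt_mul (by rw [mul_comm l]; omega)
  set s : Fin K → Fin m := fun j => ⟨_, hg j⟩ with hs
  have hu1 : ∀ u : Fin m, u.val * dr + dr ≤ m * dr := by
    intro u
    have := Nat.mul_le_mul_right dr (Nat.succ_le_of_lt u.isLt)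
    rwa [Nat.succ_mul] at this
  have hu2 : ∀ u : Fin m, u.val * l + l ≤ m * l := by
    intro u
    have := Nat.mul_le_mul_right l (Nat.succ_le_of_lt u.isLt)
    rwa [Nat.succ_mul] at this
  have hs1 : ∀ (u : Fin m) (j : Fin K), j.val < m * dr →
      (s j = u ↔ u.val * dr ≤ j.val ∧ j.val < u.val * dr + dr) := by
    intro u j hj
    rw [Fin.ext_iff]
    simp only [hs, if_pos hj]
    rw [Nat.div_eq_iff hdr]
    omega
  have hs2 : ∀ (u : Fin m) (j : Fin K), ¬ j.val < m * dr →
      (s j = u ↔ m * dr + u.val * l ≤ j.val ∧ j.val < m * dr + u.val * l + l) := by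
    intro u j hj
    rw [Fin.ext_iff]
    simp only [hs, if_neg hj]
    rw [Nat.div_eq_iff hl]
    omega
  refine ⟨s, ?_, ?_⟩
  · intro u
    have e : univ.filter (fun j => s j = u)
        = univ.filter (fun j : Fin K => u.val * dr ≤ j.val ∧ j.val < u.val * dr + dr)
        ∪ univ.filter (fun j : Fin K => m * dr + u.val * l ≤ j.val
            ∧ j.val < m * dr + u.val * l + l) := by
      ext j
      simp only [mem_union, mem_filter, mem_univ, true_and]
      have := hu1 u
      by_cases h : j.val < m * dr
      · rw [hs1 u j h]; omega
      · rw [hs2 u j h]; omega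
    have := hu1 u
    have := hu2 u
    rw [e, card_union_of_disjoint, bfr_Ico _ _ _ (by omega), bfr_Ico _ _ _ (by omega)]
    rw [disjoint_filter]
    intro j _ h
    omega
  · have hn : ∀ (u : Fin m) (j : Fin K), u.val * dr + dr ≤ j.val →
        dr ≤ (univ.filter (fun j' : Fin K => j' < j ∧ s j' = u)).card := by
      intro u j hj
      have := hu1 u
      have := j.isLt
      conv_lhs => rw [← bfr_Ico K (u.val * dr) dr (by omega)]
      apply card_le_card
      intro i hi
      simp only [mem_filter, mem_univ, true_and] at hi ⊢
      refine ⟨Fin.lt_def.2 (by omega), (hs1 u i (by omega)).2 hi⟩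
    set c : Fin K → ℕ := fun j => ∑ u ∈ Finset.univ.erase (s j),
            min ((Finset.univ.filter
              (fun j' : Fin K => j' < j ∧ s j' = u)).card) dr with hc
    have hc1 : ∀ j : Fin K, j.val < m * dr → dr * (j.val / dr) ≤ c j := by
      intro j hj
      have hsj : (s j).val = j.val / dr := by simp only [hs, if_pos hj]
      calc dr * (j.val / dr) = ∑ u ∈ univ.filter (fun u : Fin m => u < s j), dr := by
            rw [sum_const, ← hsj, smul_eq_mul, mul_comm]
            congr 1
            have : univ.filter (fun u : Fin m => u < s j) = Iio (s j) := by ext; simp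
            rw [this, Fin.card_Iio]
        _ ≤ ∑ u ∈ univ.filter (fun u : Fin m => u < s j),
              min ((Finset.univ.filter
              (fun j' : Fin K => j' < j ∧ s j' = u)).card) dr := by
            apply sum_le_sum
            intro u hu
            refine le_min (hn u j ?_) le_rfl
            have h1 : u.val < j.val / dr := by
              rw [← hsj]; exact (mem_filter.1 hu).2
            have h2 := Nat.mul_le_mul_right dr (Nat.succ_le_of_lt h1)
            have h3 := Nat.div_mul_le_self j.val dr
            rw [Nat.succ_mul] at h2
            omega
        _ ≤ c j := by
            apply sum_le_sum_of_subset
            intro u hu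
            simp only [mem_erase, mem_univ, and_true]
            exact ((mem_filter.1 hu).2).ne
    have hc2 : ∀ j : Fin K, ¬ j.val < m * dr → (m - 1) * dr ≤ c j := by
      intro j hj
      calc (m - 1) * dr = ∑ u ∈ univ.erase (s j), dr := by simp [card_erase_of_mem]
        _ ≤ c j := by
            apply sum_le_sum
            intro u _
            refine le_min (hn u j ?_) le_rfl
            have := hu1 u
            omega
    have hbound : ∀ j : Fin K, min α ((d - (c j : ℝ)) * β) ≤
        (fun t : ℕ => if t < m * dr then min α ((d - ((dr * (t / dr) : ℕ) : ℝ)) * β)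
          else min α ((d - ((m : ℝ) - 1) * dr) * β)) j.val := by
      intro j
      by_cases h : j.val < m * dr
      · simp only [if_pos h]
        have : ((dr * (j.val / dr) : ℕ) : ℝ) ≤ c j := by exact_mod_cast hc1 j h
        gcongr
      · simp only [if_neg h]
        have h' : (((m - 1) * dr : ℕ) : ℝ) ≤ c j := by exact_mod_cast hc2 j h
        rw [Nat.cast_mul, Nat.cast_sub hm1, Nat.cast_one] at h'
        gcongr
    refine (sum_le_sum fun j _ => hbound j).trans ?_
    rw [Fin.sum_univ_eq_sum_range (fun t : ℕ => if t < m * dr then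
      min α ((d - ((dr * (t / dr) : ℕ) : ℝ)) * β) else min α ((d - ((m : ℝ) - 1) * dr) * β)), hKe, sum_range_add,
      ← bfr_xsum dr m hdr (fun x => min α ((d - x) * β))]
    apply le_of_eq
    congr 1
    · exact sum_congr rfl fun t ht => if_pos (mem_range.1 ht)
    · rw [sum_congr rfl (fun t _ => if_neg (by omega))]
      rw [sum_const, card_range, nsmul_eq_mul]
      push_cast; ring

end BFRAux

/-- Theorem 4 (Case II: d_r < k_c, ρ > σ) of the BFR paper, stated
combinatorially: the minimum over all balanced orders `s` of the cut value
`Σ_j min(α, (d − c_j(s))β)`, with `c_j(s) = Σ_{u ≠ s(j)} min(n_u^{<j}(s), d_r)`,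
equals `Σ_{i=1}^m d_r·min(α,(d−(i−1)d_r)β) + m(k_c−d_r)·min(α,(d−(m−1)d_r)β)`. -/
theorem bfr_mincut_caseII (b ρ σ : ℕ) (hσρ : σ < ρ) (hρb : ρ < b)
    (m : ℕ) (hm : m = b - ρ) (hm1 : 1 ≤ m)
    (dr kc : ℕ) (hdr : 1 ≤ dr) (hdk : dr < kc)
    (d : ℕ) (hd : d = (b - σ) * dr) (K : ℕ) (hK : K = m * kc)
    (α β : ℝ) (hα : 0 ≤ α) (hβ : 0 ≤ β) :
    IsLeast {v : ℝ | ∃ s : Fin K → Fin m,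
        (∀ u : Fin m, (Finset.univ.filter (fun j => s j = u)).card = kc) ∧
        v = ∑ j : Fin K,
          min α (((d : ℝ) - ((∑ u ∈ Finset.univ.erase (s j),
            min ((Finset.univ.filter
              (fun j' : Fin K => j' < j ∧ s j' = u)).card) dr : ℕ) : ℝ)) * β)}
      ((∑ i ∈ Finset.range m, (dr : ℝ) * min α (((d : ℝ) - (i : ℝ) * dr) * β))
        + (m : ℝ) * ((kc : ℝ) - dr) * min α (((d : ℝ) - ((m : ℝ) - 1) * dr) * β)) := by
  obtain ⟨s, hs, hle⟩ := BFRAux.bfr_upper m dr kc K hm1 hdr hdk hK (d : ℝ) α β hβ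
  refine ⟨⟨s, hs, ?_⟩, ?_⟩
  · exact le_antisymm (BFRAux.bfr_lower m dr kc K hdr hdk hK (d : ℝ) α β hβ s hs) hle
  · rintro v ⟨s, hs, rfl⟩
    exact BFRAux.bfr_lower m dr kc K hdr hdk hK (d : ℝ) α β hβ s hs
end

section
/- Let b > ρ > σ ≥ 0 be integers, m = b−ρ, and integers 1 ≤ d_r < k_c; set k = m·k_c and d = (b−σ)·d_r, and let M > 0 be real with d > (m−1)d_r. Set α = M/k and F(β) = Σ_{i=1}^{m} d_r · min(α, (d − (i−1)d_r)·β) + m·(k_c − d_r) · min(α, (d − (m−1)d_r)·β). Then β₀ = α/(d − (m−1)d_r) is the minimum of { β > 0 : M ≤ F(β) }, and d·β₀ = M·d / ( k·d·(ρ−σ+1)/(b−σ) ) = M·(b−σ) / ( k·(ρ−σ+1) ). -/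
/-- BFR-MSR point of Corollary 3 (Case II: d_r < k_c, ρ > σ): with `α = M/k`,
`β₀ = α/(d − (m−1)d_r)` is the minimum `β > 0` with `M ≤ F(β)`, and
`d·β₀ = M·d/(k·d·(ρ−σ+1)/(b−σ)) = M·(b−σ)/(k·(ρ−σ+1))`. -/
theorem bfr_msr_point_caseII (b ρ σ : ℕ) (hσρ : σ < ρ) (hρb : ρ < b)
    (m : ℕ) (hm : m = b - ρ)
    (dr kc : ℕ) (hdr : 1 ≤ dr) (hdk : dr < kc)
    (k d : ℕ) (hk : k = m * kc) (hd : d = (b - σ) * dr)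
    (M : ℝ) (hM : 0 < M) (hdm : ((m : ℝ) - 1) * dr < d)
    (α β₀ : ℝ) (hα : α = M / k)
    (hβ₀ : β₀ = α / ((d : ℝ) - ((m : ℝ) - 1) * dr)) :
    IsLeast {β : ℝ | 0 < β ∧
        M ≤ (∑ i ∈ Finset.range m, (dr : ℝ) * min α (((d : ℝ) - (i : ℝ) * dr) * β))
          + (m : ℝ) * ((kc : ℝ) - dr) * min α (((d : ℝ) - ((m : ℝ) - 1) * dr) * β)} β₀
    ∧ (d : ℝ) * β₀ = M * d / ((k : ℝ) * d * ((ρ : ℝ) - σ + 1) / ((b : ℝ) - σ))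
    ∧ (d : ℝ) * β₀ = M * ((b : ℝ) - σ) / ((k : ℝ) * ((ρ : ℝ) - σ + 1)) := by
  have hmpos : 0 < m := by omega
  have hm0 : (0 : ℝ) < m := by exact_mod_cast hmpos
  have hmR : (m : ℝ) = b - ρ := by rw [hm, Nat.cast_sub hρb.le]
  have hdR : (d : ℝ) = ((b : ℝ) - σ) * dr := by
    rw [hd, Nat.cast_mul, Nat.cast_sub (by omega)]
  have hkR : (k : ℝ) = m * kc := by rw [hk, Nat.cast_mul]
  have hdr0 : (0 : ℝ) < dr := by exact_mod_cast hdr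
  have hdkR : (dr : ℝ) < kc := by exact_mod_cast hdk
  have hkc0 : (0 : ℝ) < kc := hdr0.trans hdkR
  have hk0 : (0 : ℝ) < k := by rw [hkR]; positivity
  have hσρR : (σ : ℝ) < ρ := by exact_mod_cast hσρ
  have hρbR : (ρ : ℝ) < b := by exact_mod_cast hρb
  have hbσ : (0 : ℝ) < (b : ℝ) - σ := by linarith
  have hρσ : (0 : ℝ) < (ρ : ℝ) - σ + 1 := by linarith
  have hα0 : 0 < α := by rw [hα]; positivity
  have hMα : M = m * kc * α := by rw [hα, ← hkR]; field_simp
  have hD : (0 : ℝ) < (d : ℝ) - ((m : ℝ) - 1) * dr := by linarith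
  have hDeq : (d : ℝ) - ((m : ℝ) - 1) * dr = ((ρ : ℝ) - σ + 1) * dr := by
    rw [hdR, hmR]; ring
  have hβpos : 0 < β₀ := by rw [hβ₀]; positivity
  have hDβ : ((d : ℝ) - ((m : ℝ) - 1) * dr) * β₀ = α := by
    rw [hβ₀]; field_simp
  have hfin : (d : ℝ) * β₀ = M * ((b : ℝ) - σ) / ((k : ℝ) * ((ρ : ℝ) - σ + 1)) := by
    rw [hβ₀, hDeq, hα, hdR]; field_simp
  refine ⟨⟨⟨hβpos, ?_⟩, ?_⟩, ?_, hfin⟩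
  · have hs : ∑ i ∈ Finset.range m, (dr : ℝ) * min α (((d : ℝ) - (i : ℝ) * dr) * β₀)
        = ∑ i ∈ Finset.range m, (dr : ℝ) * α := by
      refine Finset.sum_congr rfl fun i hi => ?_
      have hi' : (i : ℝ) + 1 ≤ m := by exact_mod_cast Finset.mem_range.mp hi
      rw [min_eq_left]
      rw [← hDβ]
      apply mul_le_mul_of_nonneg_right _ hβpos.le
      have := mul_le_mul_of_nonneg_right (show (i : ℝ) ≤ m - 1 by linarith) hdr0.le
      linarith
    rw [hs, hDβ, min_self, Finset.sum_const, Finset.card_range, nsmul_eq_mul, hMα]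
    apply le_of_eq
    ring
  · rintro β ⟨hβ, hle⟩
    have hs : ∑ i ∈ Finset.range m, (dr : ℝ) * min α (((d : ℝ) - (i : ℝ) * dr) * β)
        ≤ ∑ i ∈ Finset.range m, (dr : ℝ) * α :=
      Finset.sum_le_sum fun i _ => mul_le_mul_of_nonneg_left (min_le_left _ _) hdr0.le
    rw [Finset.sum_const, Finset.card_range, nsmul_eq_mul] at hs
    have hc : 0 < (m : ℝ) * ((kc : ℝ) - dr) := mul_pos hm0 (by linarith)
    have h1 : (m : ℝ) * ((kc : ℝ) - dr) * α ≤ (m : ℝ) * ((kc : ℝ) - dr) *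
        min α (((d : ℝ) - ((m : ℝ) - 1) * dr) * β) := by
      have : (m : ℝ) * ((kc : ℝ) - dr) * α = M - m * (dr * α) := by rw [hMα]; ring
      linarith
    have h2 := (le_of_mul_le_mul_left h1 hc).trans (min_le_right _ _)
    rw [← hDβ] at h2
    exact le_of_mul_le_mul_left h2 hD
  · have hd0 : (0 : ℝ) < d := by rw [hdR]; positivity
    rw [hfin]; field_simp
end

section
/- Let b > ρ > σ ≥ 0 be integers, m = b−ρ, and integers 1 ≤ d_r < k_c; set k = m·k_c, d = (b−σ)·d_r, and let M > 0 be real. Then Σ_{i=1}^{m} d_r·(d − (i−1)d_r) + m·(k_c − d_r)·(d − (m−1)d_r) = k·d·(ρ−σ+1)/(b−σ) + d²·(b−ρ)(b−ρ−1)/(2(b−σ)²), and consequently, under the constraint α = d·β, the minimum β > 0 with M ≤ Σ_{i=1}^{m} d_r · min(α, (d − (i−1)d_r)·β) + m·(k_c − d_r) · min(α, (d − (m−1)d_r)·β) gives α = d·β = M·d / ( k·d·(ρ−σ+1)/(b−σ) + d²(b−ρ)(b−ρ−1)/(2(b−σ)²) ). -/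
/-- BFR-MBR point of Corollary 3 (Case II: d_r < k_c, ρ > σ):
`Σ_{i=1}^m d_r(d−(i−1)d_r) + m(k_c−d_r)(d−(m−1)d_r)
  = kd(ρ−σ+1)/(b−σ) + d²(b−ρ)(b−ρ−1)/(2(b−σ)²)`,
and under the constraint `α = d·β` the minimum `β > 0` satisfying the file-size
bound gives `α = d·β = M·d / (kd(ρ−σ+1)/(b−σ) + d²(b−ρ)(b−ρ−1)/(2(b−σ)²))`. -/
theorem bfr_mbr_point_caseII (b ρ σ : ℕ) (hσρ : σ < ρ) (hρb : ρ < b)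
    (m : ℕ) (hm : m = b - ρ)
    (dr kc : ℕ) (hdr : 1 ≤ dr) (hdk : dr < kc)
    (k d : ℕ) (hk : k = m * kc) (hd : d = (b - σ) * dr)
    (M : ℝ) (hM : 0 < M) :
    ((∑ i ∈ Finset.range m, (dr : ℝ) * ((d : ℝ) - (i : ℝ) * dr))
        + (m : ℝ) * ((kc : ℝ) - dr) * ((d : ℝ) - ((m : ℝ) - 1) * dr)
      = (k : ℝ) * d * ((ρ : ℝ) - σ + 1) / ((b : ℝ) - σ)
        + (d : ℝ) ^ 2 * ((b : ℝ) - ρ) * ((b : ℝ) - ρ - 1) / (2 * ((b : ℝ) - σ) ^ 2))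
    ∧ IsLeast {β : ℝ | 0 < β ∧
        M ≤ (∑ i ∈ Finset.range m,
            (dr : ℝ) * min ((d : ℝ) * β) (((d : ℝ) - (i : ℝ) * dr) * β))
          + (m : ℝ) * ((kc : ℝ) - dr)
            * min ((d : ℝ) * β) (((d : ℝ) - ((m : ℝ) - 1) * dr) * β)}
      (M / ((k : ℝ) * d * ((ρ : ℝ) - σ + 1) / ((b : ℝ) - σ)
        + (d : ℝ) ^ 2 * ((b : ℝ) - ρ) * ((b : ℝ) - ρ - 1) / (2 * ((b : ℝ) - σ) ^ 2)))
    ∧ (d : ℝ) * (M / ((k : ℝ) * d * ((ρ : ℝ) - σ + 1) / ((b : ℝ) - σ)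
        + (d : ℝ) ^ 2 * ((b : ℝ) - ρ) * ((b : ℝ) - ρ - 1) / (2 * ((b : ℝ) - σ) ^ 2)))
      = M * d / ((k : ℝ) * d * ((ρ : ℝ) - σ + 1) / ((b : ℝ) - σ)
        + (d : ℝ) ^ 2 * ((b : ℝ) - ρ) * ((b : ℝ) - ρ - 1) / (2 * ((b : ℝ) - σ) ^ 2)) := by
  have hb : (0 : ℝ) < (b : ℝ) - σ := by
    have : (σ : ℝ) < b := by exact_mod_cast hσρ.trans hρb
    linarith
  have hmR : (m : ℝ) = (b : ℝ) - ρ := by rw [hm, Nat.cast_sub hρb.le]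
  have hdR : (d : ℝ) = ((b : ℝ) - σ) * dr := by
    rw [hd, Nat.cast_mul, Nat.cast_sub (hσρ.trans hρb).le]
  have hkR : (k : ℝ) = m * kc := by rw [hk, Nat.cast_mul]
  have hdr0 : (0 : ℝ) < dr := by exact_mod_cast hdr
  have hkc : (dr : ℝ) < kc := by exact_mod_cast hdk
  have hm1 : (1 : ℝ) ≤ m := by
    have : 1 ≤ m := by omega
    exact_mod_cast this
  have hρσ : (0 : ℝ) < (ρ : ℝ) - σ := by
    have : (σ : ℝ) < ρ := by exact_mod_cast hσρ
    linarith
  have hsum : ∀ n : ℕ, (∑ i ∈ Finset.range n, (dr : ℝ) * ((d : ℝ) - (i : ℝ) * dr))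
      = dr * (n * d - dr * (n * (n - 1) / 2)) := by
    intro n
    induction n with
    | zero => simp
    | succ n ih => rw [Finset.sum_range_succ, ih]; push_cast; ring
  have key : (∑ i ∈ Finset.range m, (dr : ℝ) * ((d : ℝ) - (i : ℝ) * dr))
        + (m : ℝ) * ((kc : ℝ) - dr) * ((d : ℝ) - ((m : ℝ) - 1) * dr)
      = (k : ℝ) * d * ((ρ : ℝ) - σ + 1) / ((b : ℝ) - σ)
        + (d : ℝ) ^ 2 * ((b : ℝ) - ρ) * ((b : ℝ) - ρ - 1) / (2 * ((b : ℝ) - σ) ^ 2) := by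
    rw [hsum, hkR, hdR, hmR]
    field_simp
    ring
  have hpos : 0 < (k : ℝ) * d * ((ρ : ℝ) - σ + 1) / ((b : ℝ) - σ)
        + (d : ℝ) ^ 2 * ((b : ℝ) - ρ) * ((b : ℝ) - ρ - 1) / (2 * ((b : ℝ) - σ) ^ 2) := by
    have h1 : (0 : ℝ) < k := by rw [hkR]; exact mul_pos (by linarith) (by linarith)
    have h2 : (0 : ℝ) < d := by rw [hdR]; positivity
    have h3 : (0 : ℝ) ≤ (b : ℝ) - ρ - 1 := by linarith
    have h4 : (0 : ℝ) ≤ (b : ℝ) - ρ := by linarith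
    have h5 : (0 : ℝ) < (ρ : ℝ) - σ + 1 := by linarith
    positivity
  have hmin : ∀ β : ℝ, 0 < β → (∑ i ∈ Finset.range m,
            (dr : ℝ) * min ((d : ℝ) * β) (((d : ℝ) - (i : ℝ) * dr) * β))
          + (m : ℝ) * ((kc : ℝ) - dr)
            * min ((d : ℝ) * β) (((d : ℝ) - ((m : ℝ) - 1) * dr) * β)
      = ((k : ℝ) * d * ((ρ : ℝ) - σ + 1) / ((b : ℝ) - σ)
        + (d : ℝ) ^ 2 * ((b : ℝ) - ρ) * ((b : ℝ) - ρ - 1) / (2 * ((b : ℝ) - σ) ^ 2)) * β := by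
    intro β hβ
    have hx : ∀ x : ℝ, 0 ≤ x →
        min ((d : ℝ) * β) (((d : ℝ) - x * dr) * β) = ((d : ℝ) - x * dr) * β := by
      intro x hx
      apply min_eq_right
      apply mul_le_mul_of_nonneg_right _ hβ.le
      have := mul_nonneg hx hdr0.le
      linarith
    rw [← key, hx _ (by linarith), add_mul, Finset.sum_mul]
    congr 1
    · apply Finset.sum_congr rfl
      intro i _
      rw [hx _ (Nat.cast_nonneg i)]
      ring
    · ring
  refine ⟨key, ⟨⟨div_pos hM hpos, ?_⟩, ?_⟩, ?_⟩
  · rw [hmin _ (div_pos hM hpos), mul_div_cancel₀ _ hpos.ne']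
  · rintro β ⟨hβ, h⟩
    rw [hmin β hβ] at h
    rw [div_le_iff₀ hpos]
    linarith
  · ring
end

section
/- Let k be an even integer with k ≥ 2, let d be an integer with d > k/2, and let M > 0 be real. Set α = M/k. Then β₀ = α/(d − k/2) is the minimum of { β > 0 : M ≤ Σ_{i=0}^{k/2−1} min(α, (d−i)·β) + Σ_{i=1}^{k/2} min(α, (d−i)·β) }, and d·β₀ = 2·M·d / (2·k·d − k²). -/
/-- Two-block (b=2, ρ=0, σ=1) BFR-MSR point for even `k`: with `α = M/k`,
`β₀ = α/(d − k/2)` is the minimum `β > 0` satisfying the min-cut bound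
`M ≤ Σ_{i=0}^{k/2−1} min(α,(d−i)β) + Σ_{i=1}^{k/2} min(α,(d−i)β)`, and
`d·β₀ = 2Md/(2kd − k²)`. -/
theorem bfr_msr_two_block_even (k d : ℕ) (hk2 : 2 ≤ k) (hke : Even k)
    (hd : (k : ℝ) / 2 < d) (M : ℝ) (hM : 0 < M)
    (α β₀ : ℝ) (hα : α = M / k) (hβ₀ : β₀ = α / ((d : ℝ) - (k : ℝ) / 2)) :
    IsLeast {β : ℝ | 0 < β ∧
        M ≤ (∑ i ∈ Finset.range (k / 2), min α (((d : ℝ) - (i : ℝ)) * β))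
          + ∑ i ∈ Finset.range (k / 2), min α (((d : ℝ) - ((i : ℝ) + 1)) * β)} β₀
    ∧ (d : ℝ) * β₀ = 2 * M * d / (2 * (k : ℝ) * d - (k : ℝ) ^ 2) := by
  obtain ⟨m, rfl⟩ := hke
  have hm : 1 ≤ m := by omega
  have hmR : (1 : ℝ) ≤ m := by exact_mod_cast hm
  have hdiv : (m + m) / 2 = m := by omega
  rw [hdiv]
  push_cast at *
  have e : ((m : ℝ) + m) / 2 = m := by ring
  rw [e] at hd hβ₀
  have hpos : (0 : ℝ) < d - m := by linarith
  have hαpos : 0 < α := by rw [hα]; positivity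
  have hβpos : 0 < β₀ := by rw [hβ₀]; positivity
  have hMα : M = m * α + m * α := by
    rw [hα]; field_simp
  have hmul : ((d : ℝ) - m) * β₀ = α := by
    rw [hβ₀]; field_simp
  have hconst : ∑ _i ∈ Finset.range m, α = m * α := by simp
  refine ⟨⟨⟨hβpos, ?_⟩, ?_⟩, ?_⟩
  · rw [hMα, ← hconst]
    refine add_le_add (Finset.sum_le_sum ?_) (Finset.sum_le_sum ?_)
    all_goals
      intro i hi
      have hi' : (i : ℝ) + 1 ≤ m := by exact_mod_cast Finset.mem_range.mp hi
      refine le_min le_rfl ?_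
      rw [← hmul]
      exact mul_le_mul_of_nonneg_right (by linarith) hβpos.le
  · rintro β ⟨hβ, hle⟩
    by_contra hlt
    rw [not_le] at hlt
    have h1 : ∑ i ∈ Finset.range m, min α (((d : ℝ) - (i : ℝ)) * β) ≤ m * α := by
      rw [← hconst]
      exact Finset.sum_le_sum fun i _ => min_le_left _ _
    have h2 : ∑ i ∈ Finset.range m, min α (((d : ℝ) - ((i : ℝ) + 1)) * β) < m * α := by
      rw [← hconst]
      refine Finset.sum_lt_sum (fun i _ => min_le_left _ _)
        ⟨m - 1, Finset.mem_range.mpr (by omega), ?_⟩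
      refine (min_le_right _ _).trans_lt ?_
      have hc : ((m - 1 : ℕ) : ℝ) + 1 = m := by
        rw [Nat.cast_sub hm]; simp
      rw [hc]
      calc ((d : ℝ) - m) * β < ((d : ℝ) - m) * β₀ := mul_lt_mul_of_pos_left hlt hpos
        _ = α := hmul
    linarith
  · have hden : 2 * ((m : ℝ) + m) * d - ((m : ℝ) + m) ^ 2 = 4 * m * (d - m) := by ring
    have hm0 : (m : ℝ) ≠ 0 := by positivity
    rw [hden, eq_div_iff (by positivity), hMα]
    linear_combination 4 * (m : ℝ) * d * hmul
end

section
/- Let k be an even integer with k ≥ 2, let d be an integer with d ≥ k/2, and let M > 0 be real. Then Σ_{i=0}^{k/2−1} (d−i) + Σ_{i=1}^{k/2} (d−i) = k·d − k²/4, and consequently, under the constraint α = d·β, the minimum β > 0 satisfying M ≤ Σ_{i=0}^{k/2−1} min(α,(d−i)β) + Σ_{i=1}^{k/2} min(α,(d−i)β) gives α = d·β = 4·M·d / (4·k·d − k²). -/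
/-- Two-block (b=2, ρ=0, σ=1) BFR-MBR point for even `k`:
`Σ_{i=0}^{k/2−1}(d−i) + Σ_{i=1}^{k/2}(d−i) = kd − k²/4`, and under the
constraint `α = d·β` the minimum `β > 0` satisfying the min-cut bound gives
`α = d·β = 4Md/(4kd − k²)`. -/
theorem bfr_mbr_two_block_even (k d : ℕ) (hk2 : 2 ≤ k) (hke : Even k)
    (hd : (k : ℝ) / 2 ≤ d) (M : ℝ) (hM : 0 < M) :
    ((∑ i ∈ Finset.range (k / 2), ((d : ℝ) - (i : ℝ)))
        + (∑ i ∈ Finset.range (k / 2), ((d : ℝ) - ((i : ℝ) + 1)))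
      = (k : ℝ) * d - (k : ℝ) ^ 2 / 4)
    ∧ IsLeast {β : ℝ | 0 < β ∧
        M ≤ (∑ i ∈ Finset.range (k / 2), min ((d : ℝ) * β) (((d : ℝ) - (i : ℝ)) * β))
          + ∑ i ∈ Finset.range (k / 2), min ((d : ℝ) * β) (((d : ℝ) - ((i : ℝ) + 1)) * β)}
      (M / ((k : ℝ) * d - (k : ℝ) ^ 2 / 4))
    ∧ (d : ℝ) * (M / ((k : ℝ) * d - (k : ℝ) ^ 2 / 4))
        = 4 * M * d / (4 * (k : ℝ) * d - (k : ℝ) ^ 2) := by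
  have hsum : (∑ i ∈ Finset.range (k / 2), ((d : ℝ) - (i : ℝ)))
        + (∑ i ∈ Finset.range (k / 2), ((d : ℝ) - ((i : ℝ) + 1)))
      = (k : ℝ) * d - (k : ℝ) ^ 2 / 4 := by
    obtain ⟨m, rfl⟩ := hke
    have h2 : (m + m) / 2 = m := by omega
    rw [h2]
    have key : ∀ n : ℕ, (∑ i ∈ Finset.range n, ((d : ℝ) - (i : ℝ)))
        + (∑ i ∈ Finset.range n, ((d : ℝ) - ((i : ℝ) + 1))) = 2 * n * d - (n : ℝ) ^ 2 := by
      intro n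
      induction n with
      | zero => simp
      | succ n ih =>
        rw [Finset.sum_range_succ, Finset.sum_range_succ]
        push_cast
        linarith
    rw [key m]
    push_cast
    ring
  have hk : (2 : ℝ) ≤ k := by exact_mod_cast hk2
  have hpos : 0 < (k : ℝ) * d - (k : ℝ) ^ 2 / 4 := by nlinarith
  have hmin : ∀ β : ℝ, 0 < β →
      (∑ i ∈ Finset.range (k / 2), min ((d : ℝ) * β) (((d : ℝ) - (i : ℝ)) * β))
          + ∑ i ∈ Finset.range (k / 2), min ((d : ℝ) * β) (((d : ℝ) - ((i : ℝ) + 1)) * β)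
      = ((k : ℝ) * d - (k : ℝ) ^ 2 / 4) * β := by
    intro β hβ
    rw [← hsum, add_mul, Finset.sum_mul, Finset.sum_mul]
    congr 1
    · refine Finset.sum_congr rfl fun i _ => min_eq_right ?_
      have : (0 : ℝ) ≤ i := Nat.cast_nonneg i
      exact mul_le_mul_of_nonneg_right (by linarith) hβ.le
    · refine Finset.sum_congr rfl fun i _ => min_eq_right ?_
      have : (0 : ℝ) ≤ i := Nat.cast_nonneg i
      exact mul_le_mul_of_nonneg_right (by linarith) hβ.le
  refine ⟨hsum, ⟨⟨div_pos hM hpos, ?_⟩, ?_⟩, ?_⟩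
  · rw [hmin _ (div_pos hM hpos), mul_div_cancel₀ _ hpos.ne']
  · rintro β ⟨hβ, h⟩
    rw [hmin β hβ] at h
    rw [div_le_iff₀ hpos]
    linarith
  · have h4 : 4 * (k : ℝ) * d - (k : ℝ) ^ 2 = 4 * ((k : ℝ) * d - (k : ℝ) ^ 2 / 4) := by ring
    rw [h4, mul_assoc 4 M, mul_div_mul_left _ _ (by norm_num : (4 : ℝ) ≠ 0)]
    ring
end

section
/- Let k be an odd integer with k ≥ 3, let d be an integer with d > (k+1)/2, and let M > 0 be real. Consider the bound M ≤ (⌊k/2⌋+1)·min(α, d·β) + ⌊k/2⌋·min(α, (d − ⌊k/2⌋ − 1)·β). (i) With α = M/k, the minimum β > 0 satisfying the bound is β₀ = α/(d − (k+1)/2), and d·β₀ = 2·M·d / (2·k·d − k² − k). (ii) Under the constraint α = d·β, one has (⌊k/2⌋+1)·d + ⌊k/2⌋·(d − ⌊k/2⌋ − 1) = k·d − (k²−1)/4, and the minimum β > 0 satisfying the bound gives α = d·β = 4·M·d / (4·k·d − k² + 1). -/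
/-- Two-block (b=2, ρ=0, σ=1) BFR-MSR and BFR-MBR points for odd `k`, from the
worst-case bound `M ≤ (⌊k/2⌋+1)·min(α,dβ) + ⌊k/2⌋·min(α,(d−⌊k/2⌋−1)β)`.
(i) MSR: `α = M/k`, minimum `β₀ = α/(d−(k+1)/2)`, `dβ₀ = 2Md/(2kd−k²−k)`.
(ii) MBR: `(⌊k/2⌋+1)d + ⌊k/2⌋(d−⌊k/2⌋−1) = kd − (k²−1)/4`, and under `α = dβ`
the minimum `β` gives `α = dβ = 4Md/(4kd−k²+1)`. -/
theorem bfr_two_block_odd (k d : ℕ) (hk : 3 ≤ k) (hko : Odd k)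
    (hd : ((k : ℝ) + 1) / 2 < d) (M : ℝ) (hM : 0 < M) :
    (IsLeast {β : ℝ | 0 < β ∧
        M ≤ ((k / 2 : ℕ) + 1 : ℝ) * min (M / k) ((d : ℝ) * β)
          + ((k / 2 : ℕ) : ℝ) * min (M / k) (((d : ℝ) - ((k / 2 : ℕ) : ℝ) - 1) * β)}
        ((M / k) / ((d : ℝ) - ((k : ℝ) + 1) / 2))
      ∧ (d : ℝ) * ((M / k) / ((d : ℝ) - ((k : ℝ) + 1) / 2))
          = 2 * M * d / (2 * (k : ℝ) * d - (k : ℝ) ^ 2 - k))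
    ∧ (((k / 2 : ℕ) + 1 : ℝ) * d + ((k / 2 : ℕ) : ℝ) * ((d : ℝ) - ((k / 2 : ℕ) : ℝ) - 1)
        = (k : ℝ) * d - ((k : ℝ) ^ 2 - 1) / 4)
    ∧ (IsLeast {β : ℝ | 0 < β ∧
        M ≤ ((k / 2 : ℕ) + 1 : ℝ) * min ((d : ℝ) * β) ((d : ℝ) * β)
          + ((k / 2 : ℕ) : ℝ) * min ((d : ℝ) * β) (((d : ℝ) - ((k / 2 : ℕ) : ℝ) - 1) * β)}
        (M / ((k : ℝ) * d - ((k : ℝ) ^ 2 - 1) / 4))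
      ∧ (d : ℝ) * (M / ((k : ℝ) * d - ((k : ℝ) ^ 2 - 1) / 4))
          = 4 * M * d / (4 * (k : ℝ) * d - (k : ℝ) ^ 2 + 1)) := by
  obtain ⟨m, rfl⟩ := hko
  have hm : (2 * m + 1) / 2 = m := by omega
  have hm1 : 1 ≤ m := by omega
  rw [hm]
  have hmR : (1 : ℝ) ≤ (m : ℝ) := by exact_mod_cast hm1
  push_cast at hd ⊢
  obtain ⟨x, hx⟩ : ∃ x : ℝ, x = (m : ℝ) := ⟨_, rfl⟩
  obtain ⟨e, he⟩ : ∃ e : ℝ, e = (d : ℝ) - m - 1 := ⟨_, rfl⟩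
  have hdd : (d : ℝ) = e + x + 1 := by rw [he, hx]; ring
  rw [← hx] at hd hmR ⊢
  rw [hdd] at hd ⊢
  have hepos : 0 < e := by linarith
  have hK : 0 < 2 * x + 1 := by linarith
  have e1 : e + x + 1 - (2 * x + 1 + 1) / 2 = e := by ring
  have e2 : e + x + 1 - x - 1 = e := by ring
  have e3 : (2 * x + 1) * (e + x + 1) - ((2 * x + 1) ^ 2 - 1) / 4
      = (x + 1) * (e + x + 1) + x * e := by ring
  have hD : 0 < (x + 1) * (e + x + 1) + x * e := by positivity
  rw [e1, e2, e3]
  have hα : 0 < M / (2 * x + 1) := by positivity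
  have hMα : M = (2 * x + 1) * (M / (2 * x + 1)) := by field_simp
  refine ⟨⟨⟨⟨by positivity, ?_⟩, ?_⟩, ?_⟩, rfl, ⟨⟨by positivity, ?_⟩, ?_⟩, ?_⟩
  · have h1 : e * (M / (2 * x + 1) / e) = M / (2 * x + 1) := by field_simp
    have h2 : M / (2 * x + 1) ≤ (e + x + 1) * (M / (2 * x + 1) / e) := by
      have : 0 ≤ (x + 1) * (M / (2 * x + 1) / e) := by positivity
      linarith
    rw [h1, min_self, min_eq_left h2]
    linarith
  · rintro β ⟨hβ, h⟩
    rw [div_le_iff₀ hepos]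
    by_contra! hlt
    have h1 := min_le_left (M / (2 * x + 1)) ((e + x + 1) * β)
    have h2 : min (M / (2 * x + 1)) (e * β) < M / (2 * x + 1) :=
      lt_of_le_of_lt (min_le_right _ _) (by linarith)
    have h3 := mul_le_mul_of_nonneg_left h1 (by linarith : 0 ≤ x + 1)
    have h4 := mul_lt_mul_of_pos_left h2 (by linarith : 0 < x)
    linarith
  · have : 2 * (2 * x + 1) * (e + x + 1) - (2 * x + 1) ^ 2 - (2 * x + 1)
        = 2 * (2 * x + 1) * e := by ring
    rw [this]
    field_simp
  · rw [min_self, min_eq_right (by gcongr; linarith)]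
    apply le_of_eq
    field_simp
  · rintro β ⟨hβ, h⟩
    rw [div_le_iff₀ hD]
    rw [min_self] at h
    have h4 := mul_le_mul_of_nonneg_left
      (min_le_right ((e + x + 1) * β) (e * β)) (by linarith : 0 ≤ x)
    linarith
  · have : 4 * (2 * x + 1) * (e + x + 1) - (2 * x + 1) ^ 2 + 1
        = 4 * ((x + 1) * (e + x + 1) + x * e) := by ring
    rw [this]
    field_simp
end

section
/- Let b, k, d be integers with 2 ≤ b ≤ k ≤ d and b ∣ k, and let M > 0 be real. Define γ_MBR = 2·M·d/(k·(2d − k + 1)), γ_BFR-MSR = M·d/( k·d − k²(b−1)/b ), and γ_MSR = M·d/( k·(d − k + 1) ). Then γ_MBR ≤ γ_BFR-MSR ≤ γ_MSR. -/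
/-- For `2 ≤ b ≤ k ≤ d` with `b ∣ k`, the BFR-MSR repair bandwidth
`γ_BFR-MSR = Md/(kd − k²(b−1)/b)` lies between the classical MBR bandwidth
`γ_MBR = 2Md/(k(2d−k+1))` and the MSR bandwidth `γ_MSR = Md/(k(d−k+1))`. -/
theorem bfr_msr_bandwidth_between (b k d : ℕ) (hb : 2 ≤ b) (hbk : b ≤ k)
    (hkd : k ≤ d) (hdvd : b ∣ k) (M : ℝ) (hM : 0 < M) :
    2 * M * d / ((k : ℝ) * (2 * (d : ℝ) - (k : ℝ) + 1))
        ≤ M * d / ((k : ℝ) * d - (k : ℝ) ^ 2 * ((b : ℝ) - 1) / (b : ℝ))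
    ∧ M * d / ((k : ℝ) * d - (k : ℝ) ^ 2 * ((b : ℝ) - 1) / (b : ℝ))
        ≤ M * d / ((k : ℝ) * ((d : ℝ) - (k : ℝ) + 1)) := by
  obtain ⟨c, rfl⟩ := hdvd
  have hc : 1 ≤ c := by
    rcases Nat.eq_zero_or_pos c with h | h
    · subst h
      omega
    · exact h
  have hb' : (2 : ℝ) ≤ b := by exact_mod_cast hb
  have hc' : (1 : ℝ) ≤ c := by exact_mod_cast hc
  have hkd' : (b : ℝ) * c ≤ d := by exact_mod_cast hkd
  push_cast
  have hb0 : (b : ℝ) ≠ 0 := by positivity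
  have hk : (0 : ℝ) < b * c := by positivity
  have hden : (b : ℝ) * c * d - (b * c) ^ 2 * (b - 1) / b = b * c * (d - b * c + c) := by
    field_simp
    ring
  have hMd : 0 ≤ M * (d : ℝ) := by positivity
  have h2c : 2 * (c : ℝ) ≤ b * c := by nlinarith
  rw [hden]
  constructor
  · rw [show 2 * M * (d : ℝ) / (b * c * (2 * d - b * c + 1))
        = M * d / (b * c * ((2 * d - b * c + 1) / 2)) by
      have : 2 * (d : ℝ) - b * c + 1 ≠ 0 := by linarith
      field_simp]
    apply div_le_div_of_nonneg_left hMd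
    · apply mul_pos hk
      linarith
    · apply mul_le_mul_of_nonneg_left _ hk.le
      linarith
  · apply div_le_div_of_nonneg_left hMd
    · apply mul_pos hk
      linarith
    · apply mul_le_mul_of_nonneg_left _ hk.le
      linarith
end

section
/- Let p ≥ 2 be an integer and set b = p² + p + 1. Let k, d be real numbers with k > 0. Then d − k(p+1)²/b + (p+1) = d − k(b−1)/b if and only if k = b; and likewise 2d − k(p+1)²/b + (p+1) = 2d − k(b−1)/b if and only if k = b. Consequently, whenever M, d > 0 and the relevant denominators are positive, the repair bandwidth M·d/( k·( d − k(p+1)²/b + p+1 ) ) of the projective-plane construction equals the optimal BFR-MSR bandwidth M·d/( k·d − k²(b−1)/b ) if and only if k = b, and the construction's MBR value 2·M·d/( k·( 2d − k(p+1)²/b + p+1 ) ) equals the optimal BFR-MBR value M·d/( k·d − k²(b−1)/(2b) ) if and only if k = b. -/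
/-- The projective-plane based construction (Construction II, b = p²+p+1)
achieves the optimal BFR-MSR (resp. BFR-MBR) point if and only if `k = b`:
the denominator identities hold iff `k = b`, and consequently the construction's
repair bandwidths equal the optimal ones iff `k = b` (assuming `M, d > 0` and
positive denominators). -/
theorem projective_plane_bfr_optimal_iff (p : ℕ) (hp : 2 ≤ p)
    (b : ℝ) (hb : b = (p : ℝ) ^ 2 + p + 1)
    (k d M : ℝ) (hk : 0 < k) (hM : 0 < M) (hd : 0 < d)
    (hden1 : 0 < k * (d - k * ((p : ℝ) + 1) ^ 2 / b + ((p : ℝ) + 1)))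
    (hden2 : 0 < k * d - k ^ 2 * (b - 1) / b)
    (hden3 : 0 < k * (2 * d - k * ((p : ℝ) + 1) ^ 2 / b + ((p : ℝ) + 1)))
    (hden4 : 0 < k * d - k ^ 2 * (b - 1) / (2 * b)) :
    ((d - k * ((p : ℝ) + 1) ^ 2 / b + ((p : ℝ) + 1) = d - k * (b - 1) / b) ↔ k = b)
    ∧ ((2 * d - k * ((p : ℝ) + 1) ^ 2 / b + ((p : ℝ) + 1) = 2 * d - k * (b - 1) / b) ↔ k = b)
    ∧ ((M * d / (k * (d - k * ((p : ℝ) + 1) ^ 2 / b + ((p : ℝ) + 1)))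
          = M * d / (k * d - k ^ 2 * (b - 1) / b)) ↔ k = b)
    ∧ ((2 * M * d / (k * (2 * d - k * ((p : ℝ) + 1) ^ 2 / b + ((p : ℝ) + 1)))
          = M * d / (k * d - k ^ 2 * (b - 1) / (2 * b))) ↔ k = b) := by
  have hq : (0 : ℝ) < (p : ℝ) + 1 := by positivity
  have hb0 : 0 < b := by rw [hb]; positivity
  have hbne : b ≠ 0 := hb0.ne'
  have key : ∀ c : ℝ, c - k * ((p : ℝ) + 1) ^ 2 / b + ((p : ℝ) + 1)
      = c - k * (b - 1) / b + ((p : ℝ) + 1) * (b - k) / b := by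
    intro c
    have h : ((p : ℝ) + 1) ^ 2 = (b - 1) + ((p : ℝ) + 1) := by rw [hb]; ring
    rw [h]
    field_simp
    ring
  have iff1 : ∀ c : ℝ, (c - k * ((p : ℝ) + 1) ^ 2 / b + ((p : ℝ) + 1)
      = c - k * (b - 1) / b) ↔ k = b := by
    intro c
    rw [key c, add_eq_left, div_eq_zero_iff, mul_eq_zero]
    constructor
    · rintro ((h | h) | h)
      · exact absurd h hq.ne'
      · linarith
      · exact absurd h hbne
    · intro h
      exact Or.inl (Or.inr (by linarith))
  have dinj : ∀ a x y : ℝ, a ≠ 0 → (a / x = a / y ↔ x = y) := by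
    intro a x y ha
    rw [div_eq_mul_inv, div_eq_mul_inv, mul_right_inj' ha, inv_inj]
  refine ⟨iff1 d, iff1 (2 * d), ?_, ?_⟩
  · rw [← iff1 d]
    have e : k * d - k ^ 2 * (b - 1) / b = k * (d - k * (b - 1) / b) := by ring
    rw [e] at hden2 ⊢
    rw [dinj _ _ _ (mul_pos hM hd).ne', mul_right_inj' hk.ne']
  · rw [← iff1 (2 * d)]
    have e : M * d / (k * d - k ^ 2 * (b - 1) / (2 * b))
        = 2 * M * d / (k * (2 * d - k * (b - 1) / b)) := by
      have e2 : k * (2 * d - k * (b - 1) / b)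
          = 2 * (k * d - k ^ 2 * (b - 1) / (2 * b)) := by
        field_simp
      rw [e2, mul_assoc, mul_div_mul_left _ _ two_ne_zero]
    have hMd : 2 * M * d ≠ 0 := by positivity
    rw [e, dinj _ _ _ hMd, mul_right_inj' hk.ne']
end

section
/- Let b ≥ 3 and σ be integers with 1 ≤ σ ≤ b − 2, and let k, d, M be positive reals with all denominators below nonzero. Then M·d·(b−σ−1) / ( k·( d(b−σ−1) − k(b−1)(b−σ)/b + (b−σ) ) ) = M·d / ( k·d − k²(b−σ)/b ) if and only if k = b/σ. -/
/-- The DCBD-based construction (Construction III) with an MSR sub-code achieves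
the optimal BFR-MSR repair bandwidth if and only if `k = b/σ`. -/
theorem dcbd_bfr_msr_optimal_iff (b σ : ℕ) (hb : 3 ≤ b) (hσ1 : 1 ≤ σ)
    (hσ2 : σ ≤ b - 2) (k d M : ℝ) (hk : 0 < k) (hd : 0 < d) (hM : 0 < M)
    (hden1 : k * (d * ((b : ℝ) - σ - 1) - k * ((b : ℝ) - 1) * ((b : ℝ) - σ) / b
        + ((b : ℝ) - σ)) ≠ 0)
    (hden2 : k * d - k ^ 2 * ((b : ℝ) - σ) / b ≠ 0) :
    (M * d * ((b : ℝ) - σ - 1)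
        / (k * (d * ((b : ℝ) - σ - 1) - k * ((b : ℝ) - 1) * ((b : ℝ) - σ) / b
            + ((b : ℝ) - σ)))
      = M * d / (k * d - k ^ 2 * ((b : ℝ) - σ) / b))
    ↔ k = (b : ℝ) / σ := by
  have hs : (0 : ℝ) < σ := by exact_mod_cast hσ1
  have hb0 : (0 : ℝ) < b := by exact_mod_cast (by omega : 0 < b)
  have hbs : (0 : ℝ) < (b : ℝ) - σ := by
    have : (σ : ℝ) < b := by exact_mod_cast (by omega : σ < b)
    linarith
  rw [div_eq_div_iff hden1 hden2, eq_div_iff hs.ne', ← sub_eq_zero]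
  have key : M * d * ((b : ℝ) - σ - 1) * (k * d - k ^ 2 * ((b : ℝ) - σ) / b)
      - M * d * (k * (d * ((b : ℝ) - σ - 1) - k * ((b : ℝ) - 1) * ((b : ℝ) - σ) / b
            + ((b : ℝ) - σ)))
      = (M * d * k * ((b : ℝ) - σ) / b) * (k * σ - b) := by
    field_simp
    ring
  have hpos : M * d * k * ((b : ℝ) - σ) / b ≠ 0 := by positivity
  rw [key, mul_eq_zero, or_iff_right hpos, sub_eq_zero]
end

section
/- Let b ≥ 3 and σ be integers with 1 ≤ σ ≤ b − 2, and let k, d, M be positive reals with all denominators below nonzero. Then 2·M·d·(b−σ−1) / ( k·( 2d(b−σ−1) − k(b−1)(b−σ)/b + (b−σ) ) ) = M·d / ( k·d − k²(b−σ)(b+σ−1)/(2b²) ) if and only if k = b²/(b + σ² − 1). -/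
/-- The DCBD-based construction (Construction III) with a product-matrix MBR
sub-code achieves the optimal BFR-MBR point if and only if `k = b²/(b+σ²−1)`. -/
theorem dcbd_bfr_mbr_optimal_iff (b σ : ℕ) (hb : 3 ≤ b) (hσ1 : 1 ≤ σ)
    (hσ2 : σ ≤ b - 2) (k d M : ℝ) (hk : 0 < k) (hd : 0 < d) (hM : 0 < M)
    (hden1 : k * (2 * d * ((b : ℝ) - σ - 1) - k * ((b : ℝ) - 1) * ((b : ℝ) - σ) / b
        + ((b : ℝ) - σ)) ≠ 0)
    (hden2 : k * d - k ^ 2 * ((b : ℝ) - σ) * ((b : ℝ) + σ - 1) / (2 * (b : ℝ) ^ 2) ≠ 0) :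
    (2 * M * d * ((b : ℝ) - σ - 1)
        / (k * (2 * d * ((b : ℝ) - σ - 1) - k * ((b : ℝ) - 1) * ((b : ℝ) - σ) / b
            + ((b : ℝ) - σ)))
      = M * d / (k * d - k ^ 2 * ((b : ℝ) - σ) * ((b : ℝ) + σ - 1) / (2 * (b : ℝ) ^ 2)))
    ↔ k = (b : ℝ) ^ 2 / ((b : ℝ) + (σ : ℝ) ^ 2 - 1) := by
  have hB : (0 : ℝ) < b := by
    have : 0 < b := by omega
    exact_mod_cast this
  have hS : (0 : ℝ) < (b : ℝ) - σ := by
    have : σ < b := by omega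
    have h : (σ : ℝ) < b := by exact_mod_cast this
    linarith
  have hB1 : (3 : ℝ) ≤ b := by exact_mod_cast hb
  have hQ : (0 : ℝ) < (b : ℝ) + (σ : ℝ) ^ 2 - 1 := by
    have := sq_nonneg (σ : ℝ)
    linarith
  rw [div_eq_div_iff hden1 hden2, eq_div_iff hQ.ne', ← sub_eq_zero,
    ← sub_eq_zero (a := k * _)]
  have key : 2 * M * d * ((b : ℝ) - σ - 1)
        * (k * d - k ^ 2 * ((b : ℝ) - σ) * ((b : ℝ) + σ - 1) / (2 * (b : ℝ) ^ 2))
      - M * d * (k * (2 * d * ((b : ℝ) - σ - 1) - k * ((b : ℝ) - 1) * ((b : ℝ) - σ) / b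
            + ((b : ℝ) - σ)))
      = (M * d * k * ((b : ℝ) - σ) / (b : ℝ) ^ 2)
        * (k * ((b : ℝ) + (σ : ℝ) ^ 2 - 1) - (b : ℝ) ^ 2) := by
    field_simp
    ring
  have hc : M * d * k * ((b : ℝ) - σ) / (b : ℝ) ^ 2 ≠ 0 := by positivity
  rw [key, mul_eq_zero, or_iff_right hc]
end

section
/- Let K_L > 0 and M > 0 be reals, let b_L, ρ_L be integers with b_L > ρ_L ≥ 0, and let l be a positive integer with l ≥ ⌈M/K_L⌉. Suppose h_1, …, h_l are reals with 0 ≤ h_i ≤ K_L for all i and Σ_{i=1}^{l} h_i ≥ M, and suppose b_1, …, b_l are reals with b_i ≥ h_i·(b_L − ρ_L)/K_L + ρ_L for all i ≤ l − 1 and b_l ≥ h_l·(b_L − ρ_L)/K_L. Then Σ_{i=1}^{l} b_i ≥ ⌈ M·(b_L − ρ_L)/K_L ⌉ − 1 + ( ⌈M/K_L⌉ − 1 )·ρ_L. -/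
/-- Arithmetic core of the proof of Theorem 5 (resilience bound for BFR-LRC): if
`h_1,…,h_l ∈ [0, K_L]` sum to at least `M`, with `l ≥ ⌈M/K_L⌉`, and the `b_i`
satisfy `b_i ≥ h_i(b_L−ρ_L)/K_L + ρ_L` for `i ≤ l−1` and
`b_l ≥ h_l(b_L−ρ_L)/K_L`, then
`Σ b_i ≥ ⌈M(b_L−ρ_L)/K_L⌉ − 1 + (⌈M/K_L⌉ − 1)·ρ_L`. -/
theorem bfr_lrc_resilience_core (KL M : ℝ) (hKL : 0 < KL) (hM : 0 < M)
    (bL ρL : ℕ) (hbρ : ρL < bL)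
    (l : ℕ) (hl : 1 ≤ l) (hlceil : ⌈M / KL⌉ ≤ (l : ℤ))
    (h b : ℕ → ℝ)
    (hh : ∀ i ∈ Finset.range l, 0 ≤ h i ∧ h i ≤ KL)
    (hsum : M ≤ ∑ i ∈ Finset.range l, h i)
    (hb1 : ∀ i < l - 1, h i * ((bL : ℝ) - ρL) / KL + ρL ≤ b i)
    (hb2 : h (l - 1) * ((bL : ℝ) - ρL) / KL ≤ b (l - 1)) :
    ((⌈M * ((bL : ℝ) - ρL) / KL⌉ : ℝ) - 1 + ((⌈M / KL⌉ : ℝ) - 1) * ρL)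
      ≤ ∑ i ∈ Finset.range l, b i := by
  obtain ⟨n, rfl⟩ : ∃ n, l = n + 1 := ⟨l - 1, by omega⟩
  simp only [Nat.add_sub_cancel] at hb1 hb2
  have hc : (0 : ℝ) < (bL : ℝ) - ρL := by
    have : (ρL : ℝ) < bL := by exact_mod_cast hbρ
    linarith
  have hρ : (0 : ℝ) ≤ ρL := Nat.cast_nonneg _
  have hceil : (⌈M / KL⌉ : ℝ) - 1 ≤ n := by
    have : (⌈M / KL⌉ : ℝ) ≤ ((n + 1 : ℕ) : ℝ) := by exact_mod_cast hlceil
    push_cast at this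
    linarith
  have h1 : ∑ i ∈ Finset.range n, (h i * ((bL : ℝ) - ρL) / KL + ρL)
      ≤ ∑ i ∈ Finset.range n, b i :=
    Finset.sum_le_sum fun i hi => hb1 i (Finset.mem_range.mp hi)
  rw [Finset.sum_add_distrib, ← Finset.sum_div, ← Finset.sum_mul] at h1
  simp only [Finset.sum_const, Finset.card_range, nsmul_eq_mul] at h1
  rw [Finset.sum_range_succ] at hsum ⊢
  have h2 : M * ((bL : ℝ) - ρL) / KL
      ≤ (∑ i ∈ Finset.range n, h i + h n) * ((bL : ℝ) - ρL) / KL := by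
    gcongr
  rw [add_mul, add_div] at h2
  have h3 := Int.ceil_lt_add_one (M * ((bL : ℝ) - ρL) / KL)
  have h4 := mul_le_mul_of_nonneg_right hceil hρ
  linarith
end
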